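/- (Claim 1) Let N ≥ 1, c₀ ∈ ℝ^N, and β̄ ∈ ℝ^{2N−1} componentwise nonnegative, and let Z = Z(G^{PE},c₀,β̄). Let c ∈ ℝ^N be nonzero, let l be an index maximizing |c_l| with c_l > 0, and let j ≤ l ≤ k be the maximal block of consecutive indices with c_i = c_l for all j ≤ i ≤ k (i.e., c_{j−1} ≠ c_l if j > 1 and c_{k+1} ≠ c_l if k < N). If z = c₀ + G^{PE}β with −β̄ ≤ β ≤ β̄ satisfies ⟨c,z⟩ = max_{z'∈Z} ⟨c,z'⟩, then: (1) β_{N+j−1} = β̄_{N+j−1} whenever j > 1, and (2) β_{N+k} = −β̄_{N+k} whenever k < N. -/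

import Mathlib

open Matrix Finset

noncomputable section

/-- The zonotope `Z(G, c, β̄) = {c + Gβ : -β̄ ≤ β ≤ β̄}`. -/
def zonotope {N : ℕ} {ι : Type*} [Fintype ι] (G : Matrix (Fin N) ι ℝ) (c : Fin N → ℝ)
    (βb : ι → ℝ) : Set (Fin N → ℝ) :=
  {z | ∃ β : ι → ℝ, (∀ i, -βb i ≤ β i ∧ β i ≤ βb i) ∧ z = c + G.mulVec β}

/-- The PE generator matrix `G^{PE} ∈ ℝ^{N×(2N-1)}`: its first `N` columns (indexed by
`Sum.inl`) are the standard basis vectors `e_i`, and its last `N-1` columns (indexed by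
`Sum.inr j`, 0-indexed) are `(e_{j+1} - e_j)/√2`. -/
def GPE (N : ℕ) : Matrix (Fin N) (Fin N ⊕ Fin (N - 1)) ℝ :=
  Matrix.of fun n i =>
    match i with
    | Sum.inl m => if n = m then 1 else 0
    | Sum.inr j =>
        (if (n : ℕ) = (j : ℕ) + 1 then 1 else if (n : ℕ) = (j : ℕ) then -1 else 0) /
          Real.sqrt 2

/-- `F` is the exposed face of `Z` in the direction of the (nonzero) normal vector `v`,
i.e. the set of points of `Z` maximizing `z ↦ ⟨v, z⟩` over `Z`. -/
def IsExposedFaceWithNormal {N : ℕ} (Z F : Set (Fin N → ℝ)) (v : Fin N → ℝ) : Prop :=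
  v ≠ 0 ∧ F = {z ∈ Z | ∀ z' ∈ Z, v ⬝ᵥ z' ≤ v ⬝ᵥ z}

/-- `F` is a facet of `Z`: an exposed face whose affine span has dimension `N - 1`. -/
def IsFacet {N : ℕ} (Z F : Set (Fin N → ℝ)) : Prop :=
  (∃ v, IsExposedFaceWithNormal Z F v) ∧
    Module.finrank ℝ (affineSpan ℝ F).direction = N - 1

theorem vecMul_mul_sub_nonpos_of_isMax_zonotope {N : ℕ} {ι : Type*} [Fintype ι]
    {G : Matrix (Fin N) ι ℝ} {c₀ c : Fin N → ℝ} {βb β : ι → ℝ}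
    (hβ : ∀ i, -βb i ≤ β i ∧ β i ≤ βb i)
    (hmax : ∀ z' ∈ zonotope G c₀ βb, c ⬝ᵥ z' ≤ c ⬝ᵥ (c₀ + G.mulVec β))
    (i : ι) {t : ℝ} (ht : -βb i ≤ t ∧ t ≤ βb i) :
    (c ᵥ* G) i * (t - β i) ≤ 0 := by
  classical
  have hupd : Function.update β i t = β + Pi.single i (t - β i) := by
    ext m
    rcases eq_or_ne m i with rfl | hm
    · simp
    · simp [hm]
  have hmem : c₀ + G.mulVec (Function.update β i t) ∈ zonotope G c₀ βb := by
    refine ⟨_, fun m => ?_, rfl⟩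
    rcases eq_or_ne m i with rfl | hm
    · simpa using ht
    · simpa [hm] using hβ m
  have h := hmax _ hmem
  rw [hupd, mulVec_add, ← add_assoc, dotProduct_add c (c₀ + G.mulVec β), dotProduct_mulVec,
    dotProduct_single] at h
  linarith

theorem eq_upper_of_isMax_zonotope {N : ℕ} {ι : Type*} [Fintype ι]
    {G : Matrix (Fin N) ι ℝ} {c₀ c : Fin N → ℝ} {βb β : ι → ℝ}
    (hβ : ∀ i, -βb i ≤ β i ∧ β i ≤ βb i)
    (hmax : ∀ z' ∈ zonotope G c₀ βb, c ⬝ᵥ z' ≤ c ⬝ᵥ (c₀ + G.mulVec β))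
    {i : ι} (hi : 0 < (c ᵥ* G) i) : β i = βb i := by
  have hb := hβ i
  have h := vecMul_mul_sub_nonpos_of_isMax_zonotope hβ hmax i
    (t := βb i) ⟨by linarith, le_rfl⟩
  linarith [nonpos_of_mul_nonpos_right h hi]

theorem eq_lower_of_isMax_zonotope {N : ℕ} {ι : Type*} [Fintype ι]
    {G : Matrix (Fin N) ι ℝ} {c₀ c : Fin N → ℝ} {βb β : ι → ℝ}
    (hβ : ∀ i, -βb i ≤ β i ∧ β i ≤ βb i)
    (hmax : ∀ z' ∈ zonotope G c₀ βb, c ⬝ᵥ z' ≤ c ⬝ᵥ (c₀ + G.mulVec β))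
    {i : ι} (hi : (c ᵥ* G) i < 0) : β i = -βb i := by
  have hb := hβ i
  have h := vecMul_mul_sub_nonpos_of_isMax_zonotope hβ hmax i
    (t := -βb i) ⟨le_rfl, by linarith⟩
  nlinarith

theorem vecMul_GPE_inr {N : ℕ} (c : Fin N → ℝ) (m : Fin (N - 1)) :
    (c ᵥ* GPE N) (Sum.inr m) =
      (c ⟨m + 1, by omega⟩ - c ⟨m, by omega⟩) / Real.sqrt 2 := by
  have hcol : (fun n => GPE N n (Sum.inr m)) =
      (Real.sqrt 2)⁻¹ • (Pi.single (⟨m + 1, by omega⟩ : Fin N) (1 : ℝ) -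
        Pi.single (⟨m, by omega⟩ : Fin N) (1 : ℝ)) := by
    ext n
    simp only [GPE, of_apply, Pi.smul_apply, Pi.sub_apply, Pi.single_apply, Fin.ext_iff,
      smul_eq_mul]
    split_ifs <;> first | omega | (ring)
  rw [vecMul, hcol, dotProduct_smul, dotProduct_sub, dotProduct_single, dotProduct_single,
    smul_eq_mul]
  ring

/-- (Claim 1) Let `Z = Z(G^{PE}, c₀, β̄)` and let `c ≠ 0` with `l` a coordinate maximizing
`|c_i|`, `c_l > 0`, and `{j, …, k}` (0-indexed) the maximal block of consecutive coordinates
on which `c` equals `c_l`. If `z = c₀ + G^{PE} β` with `-β̄ ≤ β ≤ β̄` maximizes `⟨c, ·⟩` over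
`Z`, then the edge generator just below the block is saturated at `+β̄` (when `j > 0`) and
the edge generator just above the block is saturated at `-β̄` (when `k < N - 1`). -/
theorem claim_facet_edge_saturation {N : ℕ} (hN : 1 ≤ N) (c₀ : Fin N → ℝ)
    (βb : Fin N ⊕ Fin (N - 1) → ℝ) (hβb : ∀ i, 0 ≤ βb i)
    (c : Fin N → ℝ) (hc : c ≠ 0)
    (l : Fin N) (hl : ∀ i, |c i| ≤ c l) (hlpos : 0 < c l)
    (j k : ℕ) (hjl : j ≤ (l : ℕ)) (hlk : (l : ℕ) ≤ k) (hkN : k < N)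
    (hblock : ∀ i : Fin N, j ≤ (i : ℕ) → (i : ℕ) ≤ k → c i = c l)
    (hjmax : ∀ hj : 0 < j, c ⟨j - 1, by omega⟩ ≠ c l)
    (hkmax : ∀ hk : k < N - 1, c ⟨k + 1, by omega⟩ ≠ c l)
    (β : Fin N ⊕ Fin (N - 1) → ℝ) (hβ : ∀ i, -βb i ≤ β i ∧ β i ≤ βb i)
    (z : Fin N → ℝ) (hz : z = c₀ + (GPE N).mulVec β)
    (hmax : ∀ z' ∈ zonotope (GPE N) c₀ βb, c ⬝ᵥ z' ≤ c ⬝ᵥ z) :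
    (∀ hj : 0 < j, β (Sum.inr ⟨j - 1, by omega⟩) = βb (Sum.inr ⟨j - 1, by omega⟩)) ∧
    (∀ hk : k < N - 1, β (Sum.inr ⟨k, by omega⟩) = -βb (Sum.inr ⟨k, by omega⟩)) := by
  subst hz
  have hsqrt : 0 < Real.sqrt 2 := by positivity
  have hle : ∀ i, c i ≤ c l := fun i => (le_abs_self _).trans (hl i)
  refine ⟨fun hj => ?_, fun hk => ?_⟩
  · refine eq_upper_of_isMax_zonotope hβ hmax ?_
    have hcj : c ⟨j - 1 + 1, by omega⟩ = c l :=
      hblock _ (by simp only; omega) (by simp only; omega)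
    rw [vecMul_GPE_inr, hcj]
    exact div_pos (sub_pos.2 (lt_of_le_of_ne (hle _) (hjmax hj))) hsqrt
  · refine eq_lower_of_isMax_zonotope hβ hmax ?_
    have hck : c ⟨k, hkN⟩ = c l := hblock _ (by simp only; omega) le_rfl
    rw [vecMul_GPE_inr, hck]
    exact div_neg_of_neg_of_pos (sub_neg.2 (lt_of_le_of_ne (hle _) (hkmax hk))) hsqrt
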